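/- Let P be a string of length m over a finite alphabet Σ with at least two distinct symbols, and let A'(P) be the NFA obtained from the prefix automaton A(P) (states q_0,…,q_m, initial state q_0; δ(q_0,c) = {q_0,q_1} if c = P[0] and {q_0} otherwise; δ(q_i,c) = {q_{i+1}} if 1 ≤ i < m and c = P[i], ∅ otherwise) by adding a self-loop on q_m labeled P[m−1], i.e., δ'(q_m, P[m−1]) = {q_m}. Let S be a string with run-length encoding of length at least j+1 for some j ≥ 0. Then q_m ∈ δ'*(q_0, S[0..β_S(j)]) if and only if there exists t with α_S(j) ≤ t ≤ β_S(j), t ≥ m−1, and S[t−m+1..t] = P. (This is the paper's claim that the self-loop added on the final state makes any occurrence of P ending inside a run of S visible in the configuration at the end of that run.) -/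

import Mathlib

/-- Decoding of a run-length encoding: concatenation of the runs. -/
def decodeRLE {α : Type*} (r : List (α × ℕ)) : List α :=
  r.foldr (fun p acc => List.replicate p.2 p.1 ++ acc) []

/-- `IsRLE r S` : `r` is the run-length encoding of `S`
    (all run lengths are ≥ 1, adjacent runs have distinct symbols, decoding gives `S`). -/
def IsRLE {α : Type*} (r : List (α × ℕ)) (S : List α) : Prop :=
  (∀ p ∈ r, 1 ≤ p.2) ∧ List.Chain' (fun p q => p.1 ≠ q.1) r ∧ decodeRLE r = S

/-- `rleStart r k` = α(k), the starting position of run `k` (sum of lengths of runs before `k`). -/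
def rleStart {α : Type*} (r : List (α × ℕ)) (k : ℕ) : ℕ :=
  ((r.take k).map Prod.snd).sum


/-- Configurations of an NFA: set of states reachable from the set `I` by reading the string,
    iterating the transition function over the symbols. -/
def nfaDeltaStar {σ β : Type*} (δ : σ → β → Set σ) : Set σ → List β → Set σ
  | I, [] => I
  | I, c :: u => nfaDeltaStar δ (⋃ q ∈ I, δ q c) u


/-- Transition function of the modified KMP automaton `A'(P)`: as `kmpDelta`, plus a
    self-loop on the final state `|P|` labeled by `P[|P|−1]`. -/
def kmpDelta' {α : Type*} (P : List α) (q : ℕ) (c : α) : Set ℕ :=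
  {q' | (q = 0 ∧ q' = 0) ∨ (q' = q + 1 ∧ P[q]? = some c) ∨
        (q = P.length ∧ q' = P.length ∧ P[P.length - 1]? = some c)}

theorem nfaDeltaStar_append_singleton {σ β : Type*} (δ : σ → β → Set σ) (I : Set σ)
    (u : List β) (c : β) :
    nfaDeltaStar δ I (u ++ [c]) = ⋃ q ∈ nfaDeltaStar δ I u, δ q c := by
  induction u generalizing I with
  | nil => rfl
  | cons a u ih => exact ih _

/-- The configuration of `A'(P)` after reading `u`: a state `q` is active iff the prefix of `P` of
length `q` is a suffix of `u`, where for `q = |P|` a power of the last symbol of `P` may follow. -/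
theorem mem_nfaDeltaStar_kmpDelta'_iff {α : Type*} (P : List α) (z : α)
    (hz : P[P.length - 1]? = some z) (u : List α) (q : ℕ) :
    q ∈ nfaDeltaStar (kmpDelta' P) {0} u ↔
      q ≤ P.length ∧ ∃ k w, u = w ++ List.replicate k z ∧ P.take q <:+ w ∧
        (k = 0 ∨ q = P.length) := by
  have hP : 0 < P.length := by
    have := (List.getElem?_eq_some_iff.1 hz).1
    omega
  induction u using List.reverseRecOn generalizing q with
  | nil =>
    simp only [nfaDeltaStar, Set.mem_singleton_iff]
    constructor
    · rintro rfl
      exact ⟨Nat.zero_le _, 0, [], by simp⟩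
    · rintro ⟨hq, k, w, hw, hs, -⟩
      obtain ⟨rfl, -⟩ := List.append_eq_nil_iff.1 hw.symm
      have := congrArg List.length (List.suffix_nil.1 hs)
      simp only [List.length_take, List.length_nil] at this
      omega
  | append_singleton u c ih =>
    simp only [nfaDeltaStar_append_singleton, Set.mem_iUnion, exists_prop]
    constructor
    · rintro ⟨p, hp, hpq⟩
      obtain ⟨hpl, k, w, hu, hs, hk⟩ := (ih p).1 hp
      rcases hpq with ⟨-, rfl⟩ | ⟨rfl, hc⟩ | ⟨rfl, rfl, hc⟩
      · exact ⟨Nat.zero_le _, 0, u ++ [c], by simp⟩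
      · obtain ⟨hlt, -⟩ := List.getElem?_eq_some_iff.1 hc
        obtain rfl : k = 0 := hk.resolve_right hlt.ne
        refine ⟨hlt, 0, u ++ [c], by simp, ?_, Or.inl rfl⟩
        rw [List.take_add_one, hc, hu]
        obtain ⟨v, rfl⟩ := hs
        exact ⟨v, by simp⟩
      · obtain rfl : z = c := Option.some.inj (hz.symm.trans hc)
        exact ⟨le_rfl, k + 1, w, by rw [hu, List.replicate_succ', List.append_assoc], hs, Or.inr rfl⟩
    · rintro ⟨hq, k, w, hu, hs, hk⟩
      cases k with
      | zero =>
        cases q with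
        | zero => exact ⟨0, (ih 0).2 ⟨Nat.zero_le _, 0, u, by simp⟩, Or.inl ⟨rfl, rfl⟩⟩
        | succ n =>
          simp only [List.replicate_zero, List.append_nil] at hu
          rw [← hu, List.take_add_one, List.getElem?_eq_getElem hq] at hs
          obtain ⟨v, hv⟩ := hs
          rw [Option.toList_some, ← List.append_assoc] at hv
          obtain ⟨hv, hc⟩ := List.append_inj' hv rfl
          refine ⟨n, (ih n).2 ⟨by omega, 0, u, by simp, ⟨v, hv⟩, Or.inl rfl⟩, Or.inr (Or.inl ⟨rfl, ?_⟩)⟩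
          rw [List.getElem?_eq_getElem hq]
          exact congrArg some (List.singleton_inj.1 hc)
      | succ k =>
        obtain rfl := hk.resolve_left k.succ_ne_zero
        rw [List.replicate_succ', ← List.append_assoc] at hu
        obtain ⟨hu, hc⟩ := List.append_inj' hu rfl
        obtain rfl := List.singleton_inj.1 hc
        exact ⟨P.length, (ih _).2 ⟨le_rfl, k, w, hu, hs, Or.inr rfl⟩, Or.inr (Or.inr ⟨rfl, rfl, hz⟩)⟩

theorem decodeRLE_append {α : Type*} (r s : List (α × ℕ)) :
    decodeRLE (r ++ s) = decodeRLE r ++ decodeRLE s := by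
  induction r with
  | nil => rfl
  | cons p r ih =>
    change List.replicate p.2 p.1 ++ decodeRLE (r ++ s) =
      (List.replicate p.2 p.1 ++ decodeRLE r) ++ decodeRLE s
    rw [ih, List.append_assoc]

theorem length_decodeRLE {α : Type*} (r : List (α × ℕ)) :
    (decodeRLE r).length = (r.map Prod.snd).sum := by
  induction r with
  | nil => rfl
  | cons p r ih =>
    change (List.replicate p.2 p.1 ++ decodeRLE r).length = _
    simp [ih]

/-- A string splits around its run `j`, whose symbol differs from the symbol just before it. -/
theorem IsRLE.exists_split {α : Type*} {r : List (α × ℕ)} {S : List α} (h : IsRLE r S)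
    {j : ℕ} (hj : j < r.length) :
    ∃ X Y : List α, S = X ++ List.replicate r[j].2 r[j].1 ++ Y ∧ X.length = rleStart r j ∧
      ∀ V, X ≠ V ++ [r[j].1] := by
  obtain ⟨hpos, hchain, rfl⟩ := h
  refine ⟨decodeRLE (r.take j), decodeRLE (r.drop (j + 1)), ?_, length_decodeRLE _, ?_⟩
  · conv_lhs => rw [← List.take_append_drop j r, List.drop_eq_getElem_cons hj, decodeRLE_append]
    rw [List.append_assoc]
    rfl
  · intro V hV
    cases j with
    | zero => simp [decodeRLE] at hV
    | succ i =>
      have hi : i < r.length := by omega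
      rw [List.take_add_one, List.getElem?_eq_getElem hi, Option.toList_some,
        decodeRLE_append] at hV
      have hrun : decodeRLE [r[i]] = List.replicate (r[i].2 - 1) r[i].1 ++ [r[i].1] := by
        rw [← List.replicate_succ', Nat.sub_add_cancel (hpos _ (List.getElem_mem hi))]
        exact List.append_nil _
      rw [hrun, ← List.append_assoc] at hV
      exact List.isChain_iff_getElem.1 hchain i hj (List.singleton_inj.1 (List.append_inj' hV rfl).2)

theorem List.take_drop_eq_iff_suffix_take {α : Type*} {P S : List α} {n : ℕ}
    (hn : n ≤ S.length) (hP : P.length ≤ n) :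
    (S.drop (n - P.length)).take P.length = P ↔ P <:+ S.take n := by
  rw [List.suffix_iff_eq_drop, List.length_take, min_eq_left hn, List.drop_take,
    Nat.sub_sub_self hP, eq_comm]

theorem stmt_17 {α : Type*} [Fintype α] (P S : List α) (rS : List (α × ℕ))
    (hS : IsRLE rS S) (hdist : ∃ x ∈ P, ∃ y ∈ P, x ≠ y)
    (j : ℕ) (hj : j + 1 ≤ rS.length) :
    P.length ∈ nfaDeltaStar (kmpDelta' P) {0} (S.take (rleStart rS (j + 1))) ↔
      ∃ t, rleStart rS j ≤ t ∧ t ≤ rleStart rS j + (rS[j]'(by omega)).2 - 1 ∧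
        P.length - 1 ≤ t ∧ (S.drop (t + 1 - P.length)).take P.length = P := by
  have hP : 0 < P.length := by
    obtain ⟨x, hx, -⟩ := hdist
    exact List.length_pos_of_mem hx
  have hPne : P ≠ [] := List.length_pos_iff.1 hP
  set z := P.getLast hPne
  have hz : P[P.length - 1]? = some z := by
    rw [← List.getLast?_eq_getElem?, List.getLast?_eq_getLast_of_ne_nil hPne]
  have hl : 1 ≤ rS[j].2 := hS.1 _ (List.getElem_mem _)
  obtain ⟨X, Y, hXY, hX, hne⟩ := hS.exists_split (j := j) hj
  have hstart : rleStart rS (j + 1) = rleStart rS j + rS[j].2 := by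
    rw [rleStart, rleStart, List.take_add_one, List.getElem?_eq_getElem hj, Option.toList_some]
    simp only [List.map_append, List.map_singleton, List.sum_append, List.sum_singleton]
  generalize rS[j].1 = c at hXY hne
  generalize rS[j].2 = l at hl hXY hstart ⊢
  have hlast : ∀ {w : List α}, P <:+ w → ∃ v, w = v ++ [z] := by
    rintro _ ⟨v, rfl⟩
    exact ⟨v ++ P.dropLast, by rw [List.append_assoc, List.dropLast_append_getLast hPne]⟩
  have htake : ∀ i ≤ l, S.take (X.length + i) = X ++ List.replicate i c := by
    intro i hi
    rw [hXY, List.append_assoc, List.take_length_add_append,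
      List.take_append_of_le_length (by simpa using hi), List.take_replicate, min_eq_left hi]
  have hlen : X.length + l ≤ S.length := by simp [hXY]
  rw [mem_nfaDeltaStar_kmpDelta'_iff P z hz, hstart, ← hX, htake l le_rfl]
  simp only [List.take_length, le_refl, true_and, or_true, and_true]
  constructor
  · rintro ⟨k, w, hw, hs⟩
    obtain ⟨v, hv⟩ := hlast hs
    have hcz : c = z := by
      obtain ⟨l, rfl⟩ := Nat.exists_eq_add_of_le' hl
      rw [List.replicate_succ', ← List.append_assoc X, hv, List.append_assoc v, List.singleton_append,
        ← List.replicate_succ, List.replicate_succ', ← List.append_assoc v] at hw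
      exact List.singleton_inj.1 (List.append_inj' hw rfl).2
    subst hcz
    have hkl : k < l := by
      by_contra! hlk
      obtain ⟨d, rfl⟩ := Nat.exists_eq_add_of_le' hlk
      rw [List.replicate_add, ← List.append_assoc] at hw
      have hXw := List.append_cancel_right hw
      rw [hv, List.append_assoc, List.singleton_append, ← List.replicate_succ,
        List.replicate_succ', ← List.append_assoc] at hXw
      exact hne _ hXw
    have hwX : w = X ++ List.replicate (l - k) z := by
      refine List.append_cancel_right (bs := List.replicate k z) ?_
      rw [← hw, List.append_assoc, ← List.replicate_add, Nat.sub_add_cancel hkl.le]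
    have hPw := hs.length_le
    simp only [hwX, List.length_append, List.length_replicate] at hPw
    refine ⟨X.length + (l - k) - 1, by omega, by omega, by omega, ?_⟩
    rw [Nat.sub_add_cancel (by omega), List.take_drop_eq_iff_suffix_take (by omega) hPw,
      htake _ (by omega), ← hwX]
    exact hs
  · rintro ⟨t, ht₁, ht₂, ht₃, ht⟩
    obtain ⟨i, rfl⟩ := Nat.exists_eq_add_of_le ht₁
    rw [List.take_drop_eq_iff_suffix_take (by omega) (by omega), add_assoc,
      htake _ (by omega)] at ht
    obtain ⟨v, hv⟩ := hlast ht
    have hcz : c = z := by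
      rw [List.replicate_succ', ← List.append_assoc] at hv
      exact List.singleton_inj.1 (List.append_inj' hv rfl).2
    refine ⟨l - (i + 1), _, ?_, ht⟩
    rw [← hcz, List.append_assoc, ← List.replicate_add, Nat.add_sub_cancel' (by omega)]
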